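/- If G and H are finite 3-regular simple graphs on the same number n of vertices that have the same (n−2)-deck and are not isomorphic, then G has girth at least 5 (in particular, G has no triangle and no 4-cycle). -/

import Mathlib

open SimpleGraph

/-- Two graphs have the same `k`-deck if there is a bijection between their `k`-element
vertex subsets under which corresponding induced subgraphs are isomorphic. -/
def SameDeck {V W : Type*} [Fintype V] [Fintype W] [DecidableEq V] [DecidableEq W]
    (G : SimpleGraph V) (H : SimpleGraph W) (k : ℕ) : Prop :=
  ∃ e : {s : Finset V // s.card = k} ≃ {s : Finset W // s.card = k},
    ∀ s : {s : Finset V // s.card = k},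
      Nonempty ((G.induce (↑s.1 : Set V)) ≃g (H.induce (↑(e s).1 : Set W)))

open Finset in
/-- Two pairs of equinumerous finite sets with the same union and the same intersection coincide
up to order as soon as the sets of one pair differ in at most one element. -/
theorem eq_or_swap_of_inter_eq_of_union_eq {α : Type*} [DecidableEq α] {A B A' B' : Finset α}
    (hinter : A ∩ B = A' ∩ B') (hunion : A ∪ B = A' ∪ B') (hAB : #A = #B)
    (hAB' : #A' = #B') (hdiff : #(A \ B) ≤ 1) :
    (A' = A ∧ B' = B) ∨ (A' = B ∧ B' = A) := by
  have h₁ := card_union_add_card_inter A B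
  have h₂ := card_union_add_card_inter A' B'
  rw [hinter, hunion] at h₁
  have hi (x : α) : x ∈ A ∧ x ∈ B ↔ x ∈ A' ∧ x ∈ B' := by
    simpa using Finset.ext_iff.1 hinter x
  have hu (x : α) : x ∈ A ∨ x ∈ B ↔ x ∈ A' ∨ x ∈ B' := by
    simpa using Finset.ext_iff.1 hunion x
  by_cases hsub : A' ⊆ A
  · have hA : A' = A := eq_of_subset_of_card_le hsub (by omega)
    subst hA
    refine Or.inl ⟨rfl, ?_⟩
    ext x
    have := hi x
    have := hu x
    tauto
  · obtain ⟨x, hx', hx⟩ := not_subset.1 hsub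
    have hxB : x ∈ B := ((hu x).2 (Or.inl hx')).resolve_left hx
    have hdiff' : #(B \ A) ≤ 1 := by
      rwa [← card_sdiff_comm hAB]
    have hB : B = A' := by
      refine eq_of_subset_of_card_le (fun y hy => ?_) (by omega)
      by_cases hyA : y ∈ A
      · exact ((hi y).1 ⟨hyA, hy⟩).1
      · rwa [card_le_one.1 hdiff' y (by simp [hy, hyA]) x (by simp [hxB, hx])]
    subst hB
    refine Or.inr ⟨rfl, ?_⟩
    ext y
    have := hi y
    have := hu y
    tauto

namespace SimpleGraph

variable {V W : Type*} [Fintype V] [Fintype W] [DecidableEq V] [DecidableEq W]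
  {G : SimpleGraph V} {H : SimpleGraph W}

theorem degree_eq_add_sum_of_compl_eq_pair [DecidableRel G.Adj] {s : Finset V} {u v : V}
    (huv : u ≠ v) (hs : sᶜ = {u, v}) (x : V) :
    G.degree x = (if G.Adj x u then 1 else 0) + (if G.Adj x v then 1 else 0) +
      ∑ y : s, if G.Adj x y then 1 else 0 := by
  rw [← card_neighborFinset_eq_degree, neighborFinset_eq_filter, Finset.card_filter,
    ← Finset.sum_compl_add_sum s, hs, Finset.sum_pair huv,
    Finset.sum_coe_sort s fun y => if G.Adj x y then 1 else 0]

/-- An isomorphism between induced subgraphs missing two vertices each extends to the whole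
graphs when it is compatible with the adjacencies of the missing vertices. -/
theorem nonempty_iso_of_compl_eq_pair (hcard : Fintype.card V = Fintype.card W)
    {s : Finset V} {t : Finset W} {u v : V} {u' v' : W} (huv' : u' ≠ v')
    (hs : sᶜ = {u, v}) (ht : tᶜ = {u', v'})
    (φ : s ≃ t) (hφ : ∀ x y : s, H.Adj (φ x) (φ y) ↔ G.Adj x y)
    (huv_adj : H.Adj u' v' ↔ G.Adj u v)
    (hu : ∀ x : s, H.Adj u' (φ x) ↔ G.Adj u x)
    (hv : ∀ x : s, H.Adj v' (φ x) ↔ G.Adj v x) :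
    Nonempty (G ≃g H) := by
  have hmem (x : V) : x ∉ s ↔ x = u ∨ x = v := by
    simpa using Finset.ext_iff.1 hs x
  have hφ_ne (x : s) : (φ x : W) ≠ u' ∧ (φ x : W) ≠ v' := by
    have := Finset.ext_iff.1 ht (φ x)
    simpa using this
  let f : V → W := fun x => if h : x ∈ s then φ ⟨x, h⟩ else if x = u then u' else v'
  have hf (x : s) : f x = φ x := by simp [f]
  have hfu : f u = u' := by simp [f, (hmem u).2]
  have hfv (h : v ≠ u) : f v = v' := by simp [f, (hmem v).2, h]
  have hcases (x : V) : (∃ y : s, x = y) ∨ x = u ∨ (x = v ∧ v ≠ u) := by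
    by_cases hx : x ∈ s
    · exact Or.inl ⟨⟨x, hx⟩, rfl⟩
    · have := (hmem x).1 hx
      grind
  clear_value f
  have hφ_inj (x y : s) (h : (φ x : W) = φ y) : x = y := φ.injective (Subtype.ext h)
  have hinj : Function.Injective f := by
    intro x y hxy
    rcases hcases x with ⟨x, rfl⟩ | rfl | ⟨rfl, hx⟩ <;>
    rcases hcases y with ⟨y, rfl⟩ | rfl | ⟨rfl, hy⟩ <;>
    grind
  have hadj (x y : V) : H.Adj (f x) (f y) ↔ G.Adj x y := by
    rcases hcases x with ⟨x, rfl⟩ | rfl | ⟨rfl, hx⟩ <;>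
    rcases hcases y with ⟨y, rfl⟩ | rfl | ⟨rfl, hy⟩ <;>
    grind [adj_comm, SimpleGraph.irrefl]
  exact ⟨⟨Equiv.ofBijective f ((Fintype.bijective_iff_injective_and_card f).2 ⟨hinj, hcard⟩),
    hadj _ _⟩⟩

/-- A regular graph is determined by an induced subgraph missing two vertices `u` and `v` if `u`
has at most one neighbor outside `v` and the neighbors of `v`. -/
theorem nonempty_iso_of_card_filter_adj_le_one [DecidableRel G.Adj] [DecidableRel H.Adj] {d : ℕ}
    (hG : G.IsRegularOfDegree d) (hH : H.IsRegularOfDegree d)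
    (hcard : Fintype.card V = Fintype.card W)
    {s : Finset V} {t : Finset W} {u v : V} {u' v' : W} (huv : u ≠ v) (huv' : u' ≠ v')
    (hs : sᶜ = {u, v}) (ht : tᶜ = {u', v'})
    (φ : s ≃ t) (hφ : ∀ x y : s, H.Adj (φ x) (φ y) ↔ G.Adj x y)
    (hdiff : (Finset.univ.filter fun x : s => G.Adj u x ∧ ¬ G.Adj v x).card ≤ 1) :
    Nonempty (G ≃g H) := by
  let A := Finset.univ.filter fun x : s => G.Adj u x
  let B := Finset.univ.filter fun x : s => G.Adj v x
  let A' := Finset.univ.filter fun x : s => H.Adj u' (φ x)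
  let B' := Finset.univ.filter fun x : s => H.Adj v' (φ x)
  have hdegG := degree_eq_add_sum_of_compl_eq_pair (G := G) huv hs
  have hdegH (x : W) : d = (if H.Adj x u' then 1 else 0) + (if H.Adj x v' then 1 else 0) +
      ∑ y : s, if H.Adj x (φ y) then 1 else 0 := by
    rw [← hH.degree_eq x, degree_eq_add_sum_of_compl_eq_pair huv' ht,
      φ.sum_comp fun y : t => if H.Adj x y then 1 else 0]
  simp only [hG.degree_eq] at hdegG
  have hcount (x : s) : (if G.Adj u x then 1 else 0) + (if G.Adj v x then 1 else 0) =
      (if H.Adj u' (φ x) then 1 else 0) + (if H.Adj v' (φ x) then 1 else 0) := by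
    have h₁ := hdegG x
    have h₂ := hdegH (φ x)
    simp only [hφ] at h₂
    simp only [G.adj_comm u, G.adj_comm v, H.adj_comm u', H.adj_comm v']
    omega
  have hA := hdegG u
  have hB := hdegG v
  have hA' := hdegH u'
  have hB' := hdegH v'
  simp only [← Finset.card_filter, SimpleGraph.irrefl, if_false, G.adj_comm v u,
    H.adj_comm v' u'] at hA hB hA' hB'
  have hinter : A ∩ B = A' ∩ B' := by
    ext x
    have := hcount x
    simp only [A, B, A', B', Finset.mem_inter, Finset.mem_filter, Finset.mem_univ, true_and]
    grind
  have hunion : A ∪ B = A' ∪ B' := by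
    ext x
    have := hcount x
    simp only [A, B, A', B', Finset.mem_union, Finset.mem_filter, Finset.mem_univ, true_and]
    grind
  have hsum : A.card + B.card = A'.card + B'.card := by
    rw [← Finset.card_union_add_card_inter, hinter, hunion, Finset.card_union_add_card_inter]
  have hadj : H.Adj u' v' ↔ G.Adj u v := by
    simp only [A, B, A', B'] at hsum
    grind
  have hAB : A.card = B.card := by simp only [A, B]; omega
  have hAB' : A'.card = B'.card := by simp only [A', B']; omega
  have hAdiff : (A \ B).card ≤ 1 := by
    rwa [← Finset.filter_and_not]
  rcases eq_or_swap_of_inter_eq_of_union_eq hinter hunion hAB hAB' hAdiff with ⟨h₁, h₂⟩ | ⟨h₁, h₂⟩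
  · refine nonempty_iso_of_compl_eq_pair hcard huv' hs ht φ hφ hadj (fun x => ?_) fun x => ?_
    · simpa [A, A'] using Finset.ext_iff.1 h₁ x
    · simpa [B, B'] using Finset.ext_iff.1 h₂ x
  · refine nonempty_iso_of_compl_eq_pair hcard huv'.symm hs (by rw [ht, Finset.pair_comm]) φ hφ
      (by rwa [H.adj_comm]) (fun x => ?_) fun x => ?_
    · simpa [A, B'] using Finset.ext_iff.1 h₂ x
    · simpa [B, A'] using Finset.ext_iff.1 h₁ x

/-- Two 3-regular graphs with the same `(n-2)`-deck are isomorphic if one of them has distinct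
vertices `u`, `v` and two neighbors of `u` each of which is `v` or a neighbor of `v`. -/
theorem nonempty_iso_of_sameDeck_of_adj [DecidableRel G.Adj] [DecidableRel H.Adj]
    (hG : G.IsRegularOfDegree 3) (hH : H.IsRegularOfDegree 3)
    (hcard : Fintype.card V = Fintype.card W) (hdeck : SameDeck G H (Fintype.card V - 2))
    {u v p q : V} (huv : u ≠ v) (hpq : p ≠ q) (hup : G.Adj u p) (huq : G.Adj u q)
    (hvp : p = v ∨ G.Adj v p) (hvq : q = v ∨ G.Adj v q) :
    Nonempty (G ≃g H) := by
  obtain ⟨e, he⟩ := hdeck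
  let s : Finset V := {u, v}ᶜ
  have hs : s.card = Fintype.card V - 2 := by
    rw [Finset.card_compl, Finset.card_pair huv]
  obtain ⟨φ⟩ := he ⟨s, hs⟩
  have htwo : 2 ≤ Fintype.card V := by
    rw [← Finset.card_pair huv]
    exact Finset.card_le_univ _
  obtain ⟨u', v', huv', ht⟩ := Finset.card_eq_two.1
    (show ((e ⟨s, hs⟩).1ᶜ).card = 2 by rw [Finset.card_compl, (e ⟨s, hs⟩).2]; omega)
  refine nonempty_iso_of_card_filter_adj_le_one hG hH hcard huv huv' (compl_compl _) ht
    φ.toEquiv (fun x y => φ.map_rel_iff) ?_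
  have hsub : (Finset.univ.filter fun x : s => G.Adj u x ∧ ¬ G.Adj v x).map
      (Function.Embedding.subtype _) ⊆ G.neighborFinset u \ {p, q} := by
    intro x
    simp only [Finset.mem_map, Finset.mem_filter, Finset.mem_sdiff, mem_neighborFinset, s]
    rintro ⟨⟨y, hy⟩, ⟨-, h₁, h₂⟩, rfl⟩
    simp only [Finset.mem_compl, Finset.mem_insert, Finset.mem_singleton, not_or] at hy
    simp only [Function.Embedding.subtype_apply, Finset.mem_insert, Finset.mem_singleton]
    grind
  have hle := Finset.card_le_card hsub
  rwa [Finset.card_map, Finset.card_sdiff_of_subset (by simp [Finset.insert_subset_iff, hup, huq]),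
    Finset.card_pair hpq, card_neighborFinset_eq_degree, hG.degree_eq] at hle

end SimpleGraph

/-- If `G` and `H` are nonisomorphic 3-regular graphs on `n` vertices with the same
`(n-2)`-deck, then `G` has girth at least 5 (no cycle of length less than 5). -/
theorem girth_ge_five_of_sameDeck_not_iso
    {V W : Type*} [Fintype V] [Fintype W] [DecidableEq V] [DecidableEq W]
    (G : SimpleGraph V) (H : SimpleGraph W)
    [DecidableRel G.Adj] [DecidableRel H.Adj]
    (hG : G.IsRegularOfDegree 3) (hH : H.IsRegularOfDegree 3)
    (hcard : Fintype.card V = Fintype.card W)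
    (hdeck : SameDeck G H (Fintype.card V - 2))
    (hniso : ¬ Nonempty (G ≃g H)) :
    5 ≤ G.egirth := by
  rw [le_egirth]
  intro a w hw
  by_contra hlt
  have h₃ := hw.three_le_length
  have h₄ : w.length < 5 := by simpa using hlt
  apply hniso
  match w, hw with
  | .cons h₁ (.cons h₂ (.cons h₃ .nil)), hw =>
    exact nonempty_iso_of_sameDeck_of_adj hG hH hcard hdeck h₁.ne h₂.ne h₁ h₃.symm
      (Or.inl rfl) (Or.inr h₂)
  | .cons (v := b) h₁ (.cons (v := c) h₂ (.cons (v := d) h₃ (.cons h₄ .nil))), hw =>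
    have hnodup := hw.support_nodup
    simp only [Walk.support_cons, Walk.support_nil, List.tail_cons, List.nodup_cons,
      List.mem_cons, not_or] at hnodup
    exact nonempty_iso_of_sameDeck_of_adj hG hH hcard hdeck (Ne.symm hnodup.2.1.2.1)
      hnodup.1.2.1 h₁ h₄.symm (Or.inr h₂.symm) (Or.inr h₃)
  | .cons _ (.cons _ (.cons _ (.cons _ (.cons _ _)))), hw =>
    simp only [Walk.length_cons] at h₄
    omega
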